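/- Let n ≥ 5 and 1 ≤ p < n/(n−2), and set α₁ := c_nᵖ/(((n−2)p−2)(n−(n−2)p)). For x,y ∈ ℝⁿ₊ define G̃₀(x,y) := ∫_{ℝⁿ₊} G₀(x,z) G₀(z,y)ᵖ dz and H̃₀(x,y) := α₁|x−y|^{−((n−2)p−2)} − G̃₀(x,y). Then the integral defining G̃₀(x,y) is finite for all x,y ∈ ℝⁿ₊ with x ≠ y, and for every t > 0 and all x,y ∈ ℝⁿ₊ with x ≠ y: H̃₀(tx,ty) = t^{−((n−2)p−2)} H̃₀(x,y). In particular, for p = 1 one has H̃₀(t e_n, t e_n) = t^{4−n} H̃₀(e_n, e_n) for all t > 0. -/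

import Mathlib

open MeasureTheory Metric Filter Topology RealInnerProductSpace

noncomputable section

abbrev Euc (n : ℕ) := EuclideanSpace ℝ (Fin n)

noncomputable def surf (n : ℕ) : Measure (Euc n) := μH[(n : ℝ) - 1]

noncomputable def omegaSph (n : ℕ) : ℝ := (surf n (sphere (0 : Euc n) 1)).toReal

/-- `c_n = 1/((n-2) ω_{n-1})`. -/
noncomputable def cGreen (n : ℕ) : ℝ := 1 / (((n : ℝ) - 2) * omegaSph n)

/-- Reflection `x ↦ x*` across the hyperplane `{x_i = 0}`. -/
noncomputable def reflct {n : ℕ} (i : Fin n) (x : Euc n) : Euc n :=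
  x - (2 * x i) • EuclideanSpace.single i 1

/-- Green function of `-Δ` on the half-space `{x_i > 0}`. -/
noncomputable def G0 (n : ℕ) (i : Fin n) (x y : Euc n) : ℝ :=
  cGreen n * (‖x - y‖ ^ ((2 : ℝ) - n) - ‖x - reflct i y‖ ^ ((2 : ℝ) - n))

/-- `α₁ = c_nᵖ/(((n-2)p-2)(n-(n-2)p))`. -/
noncomputable def alpha1 (n : ℕ) (p : ℝ) : ℝ :=
  cGreen n ^ p / ((((n : ℝ) - 2) * p - 2) * ((n : ℝ) - ((n : ℝ) - 2) * p))

theorem reflct_smul {n : ℕ} (i : Fin n) (t : ℝ) (x : Euc n) :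
    reflct i (t • x) = t • reflct i x := by
  simp only [reflct, smul_sub, smul_smul, PiLp.smul_apply, smul_eq_mul]
  congr 2
  ring

theorem cGreen_nonneg {n : ℕ} (hn : 2 ≤ n) : 0 ≤ cGreen n := by
  have hn' : (2 : ℝ) ≤ n := by exact_mod_cast hn
  exact div_nonneg zero_le_one (mul_nonneg (by linarith) ENNReal.toReal_nonneg)

theorem measurable_G0_left (n : ℕ) (i : Fin n) (y : Euc n) :
    Measurable fun z => G0 n i z y := by
  unfold G0
  fun_prop

theorem measurable_G0_right (n : ℕ) (i : Fin n) (x : Euc n) :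
    Measurable fun z => G0 n i x z := by
  unfold G0 reflct
  fun_prop

theorem norm_sub_le_norm_sub_reflct {n : ℕ} {i : Fin n} {x y : Euc n}
    (hx : 0 ≤ x i) (hy : 0 ≤ y i) : ‖x - y‖ ≤ ‖x - reflct i y‖ := by
  have h : x - reflct i y = (x - y) + (2 * y i) • EuclideanSpace.single i (1 : ℝ) := by
    rw [reflct]; abel
  refine le_of_sq_le_sq ?_ (norm_nonneg _)
  rw [h, norm_add_sq_real, norm_smul, inner_smul_right, EuclideanSpace.inner_single_right]
  simp only [PiLp.sub_apply, PiLp.norm_single, norm_one, mul_one, Real.norm_eq_abs,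
    sq_abs, conj_trivial, one_mul]
  nlinarith [mul_nonneg hx hy]

theorem G0_nonneg {n : ℕ} (hn : 2 ≤ n) {i : Fin n} {x y : Euc n}
    (hx : 0 ≤ x i) (hy : 0 ≤ y i) (hxy : x ≠ y) : 0 ≤ G0 n i x y := by
  have hn' : (2 : ℝ) ≤ n := by exact_mod_cast hn
  refine mul_nonneg (cGreen_nonneg hn) (sub_nonneg.2 ?_)
  exact Real.rpow_le_rpow_of_nonpos (norm_pos_iff.2 (sub_ne_zero.2 hxy))
    (norm_sub_le_norm_sub_reflct hx hy) (by linarith)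

theorem G0_le {n : ℕ} (hn : 2 ≤ n) (i : Fin n) (x y : Euc n) :
    G0 n i x y ≤ cGreen n * ‖x - y‖ ^ ((2 : ℝ) - n) :=
  mul_le_mul_of_nonneg_left (sub_le_self _ (Real.rpow_nonneg (norm_nonneg _) _))
    (cGreen_nonneg hn)

theorem norm_smul_sub_smul_rpow {E : Type*} [NormedAddCommGroup E] [NormedSpace ℝ E]
    {t : ℝ} (ht : 0 < t) (x y : E) (s : ℝ) :
    ‖t • x - t • y‖ ^ s = t ^ s * ‖x - y‖ ^ s := by
  rw [← smul_sub, norm_smul, Real.norm_of_nonneg ht.le, Real.mul_rpow ht.le (norm_nonneg _)]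

theorem G0_smul_smul (n : ℕ) (i : Fin n) {t : ℝ} (ht : 0 < t) (x y : Euc n) :
    G0 n i (t • x) (t • y) = t ^ ((2 : ℝ) - n) * G0 n i x y := by
  simp only [G0, reflct_smul, norm_smul_sub_smul_rpow ht]
  ring

open scoped Pointwise in
theorem smul_halfspace {n : ℕ} (i : Fin n) {t : ℝ} (ht : 0 < t) :
    t • {z : Euc n | 0 < z i} = {z : Euc n | 0 < z i} := by
  ext z
  simp [Set.mem_smul_set_iff_inv_smul_mem₀ ht.ne', ht]

theorem measurableSet_halfspace {n : ℕ} (i : Fin n) : MeasurableSet {z : Euc n | 0 < z i} :=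
  measurableSet_lt measurable_const (by fun_prop)

theorem ae_halfspace_ne {n : ℕ} (hn : 0 < n) (i : Fin n) (x : Euc n) :
    ∀ᵐ z ∂(volume.restrict {z : Euc n | 0 < z i}), 0 < z i ∧ z ≠ x := by
  have : Nonempty (Fin n) := ⟨⟨0, hn⟩⟩
  filter_upwards [ae_restrict_mem (measurableSet_halfspace i),
    ae_restrict_of_ae (Measure.ae_ne volume x)] with z hz hzx using ⟨hz, hzx⟩

open scoped Pointwise in
theorem setIntegral_G0_smul_smul {n : ℕ} (hn : 2 ≤ n) (i : Fin n) (p : ℝ) {t : ℝ} (ht : 0 < t)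
    (x y : Euc n) (hy : 0 ≤ y i) :
    ∫ z in {z : Euc n | 0 < z i}, G0 n i (t • x) z * (G0 n i z (t • y)) ^ p =
      t ^ (-(((n : ℝ) - 2) * p - 2)) *
        ∫ z in {z : Euc n | 0 < z i}, G0 n i x z * (G0 n i z y) ^ p := by
  have hchange := Measure.setIntegral_comp_smul_of_pos (μ := volume)
    (fun z => G0 n i (t • x) z * (G0 n i z (t • y)) ^ p) {z : Euc n | 0 < z i} ht
  rw [smul_halfspace i ht, finrank_euclideanSpace_fin, smul_eq_mul] at hchange
  have hscale : ∫ z in {z : Euc n | 0 < z i},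
      G0 n i (t • x) (t • z) * (G0 n i (t • z) (t • y)) ^ p =
      t ^ ((2 : ℝ) - n) * t ^ (((2 : ℝ) - n) * p) *
        ∫ z in {z : Euc n | 0 < z i}, G0 n i x z * (G0 n i z y) ^ p := by
    rw [← integral_const_mul]
    refine integral_congr_ae ?_
    filter_upwards [ae_halfspace_ne (by lia) i y] with z hz
    rw [G0_smul_smul n i ht, G0_smul_smul n i ht,
      Real.mul_rpow (Real.rpow_nonneg ht.le _) (G0_nonneg hn hz.1.le hy hz.2),
      ← Real.rpow_mul ht.le]
    ring
  rw [hscale, inv_mul_eq_div, eq_div_iff (pow_ne_zero _ ht.ne')] at hchange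
  rw [← hchange, ← Real.rpow_natCast, mul_right_comm, ← Real.rpow_add ht, ← Real.rpow_add ht]
  congr 2
  ring

/-- Local integrability at the origin and decay at infinity of `|w|^{-a} max(r,|w|)^{-b}`. -/
theorem integrable_norm_rpow_mul_max_rpow {n : ℕ} (hn : 0 < n) {a b r : ℝ} (hr : 0 < r)
    (ha : a < n) (hab : (n : ℝ) < a + b) :
    Integrable fun w : Euc n => ‖w‖ ^ (-a) * (max r ‖w‖) ^ (-b) := by
  have : Nonempty (Fin n) := ⟨⟨0, hn⟩⟩
  rw [integrable_fun_norm_addHaar (volume : Measure (Euc n))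
    (f := fun t : ℝ => t ^ (-a) * (max r t) ^ (-b)), finrank_euclideanSpace_fin]
  have hpow (t : ℝ) (ht : 0 < t) (s : ℝ) : t ^ (n - 1) * t ^ s = t ^ ((n : ℝ) - 1 + s) := by
    rw [← Real.rpow_natCast, ← Real.rpow_add ht, Nat.cast_sub hn, Nat.cast_one]
  rw [← Set.Ioc_union_Ioi_eq_Ioi hr.le]
  refine IntegrableOn.union ?_ ?_
  · have h : IntegrableOn (fun t : ℝ => t ^ ((n : ℝ) - 1 + -a) * r ^ (-b)) (Set.Ioc 0 r) :=
      ((intervalIntegrable_iff_integrableOn_Ioc_of_le hr.le).1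
        (intervalIntegral.intervalIntegrable_rpow' (by linarith))).mul_const _
    refine h.congr_fun (fun t ht => ?_) measurableSet_Ioc
    simp only [smul_eq_mul]
    rw [max_eq_left ht.2, ← mul_assoc, hpow t ht.1]
  · have h : IntegrableOn (fun t : ℝ => t ^ ((n : ℝ) - 1 + (-a + -b))) (Set.Ioi r) :=
      integrableOn_Ioi_rpow_of_lt (by linarith) hr
    refine h.congr_fun (fun t ht => ?_) measurableSet_Ioi
    have ht0 : 0 < t := hr.trans ht
    simp only [smul_eq_mul]
    rw [max_eq_right (le_of_lt ht), ← Real.rpow_add ht0, hpow t ht0]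

theorem rpow_mul_rpow_le_of_le {u v r a b : ℝ} (hu : 0 ≤ u) (hr : 0 < r) (hrv : r ≤ v)
    (huv : u ≤ v) (hb : 0 ≤ b) :
    u ^ (-a) * v ^ (-b) ≤ u ^ (-a) * (max r u) ^ (-b) :=
  mul_le_mul_of_nonneg_left
    (Real.rpow_le_rpow_of_nonpos (lt_max_of_lt_left hr) (max_le hrv huv) (by linarith))
    (Real.rpow_nonneg hu _)

/-- The product of two Riesz-type singularities at distinct points is integrable. -/
theorem integrable_norm_sub_rpow_mul {n : ℕ} {a b : ℝ} (ha0 : 0 ≤ a) (hb0 : 0 ≤ b)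
    (ha : a < n) (hb : b < n) (hab : (n : ℝ) < a + b) {x y : Euc n} (hxy : x ≠ y) :
    Integrable fun z : Euc n => ‖z - x‖ ^ (-a) * ‖z - y‖ ^ (-b) := by
  have hn : 0 < n := by
    have : (0 : ℝ) < n := ha0.trans_lt ha
    exact_mod_cast this
  obtain ⟨r, hr, hrxy⟩ : ∃ r : ℝ, 0 < r ∧ 2 * r = ‖x - y‖ :=
    ⟨‖x - y‖ / 2, half_pos (norm_pos_iff.2 (sub_ne_zero.2 hxy)), by ring⟩
  have hx := (integrable_norm_rpow_mul_max_rpow hn hr ha hab).comp_sub_right x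
  have hy := (integrable_norm_rpow_mul_max_rpow hn hr hb (by linarith)).comp_sub_right y
    (f := fun w : Euc n => ‖w‖ ^ (-b) * (max r ‖w‖) ^ (-a))
  refine (hx.add hy).mono' (by fun_prop) (Eventually.of_forall fun z => ?_)
  have htri : ‖x - y‖ ≤ ‖z - x‖ + ‖z - y‖ := by
    rw [norm_sub_rev z x]
    exact norm_sub_le_norm_sub_add_norm_sub x z y
  rw [Real.norm_of_nonneg (by positivity), Pi.add_apply]
  rcases le_total ‖z - x‖ ‖z - y‖ with h | h
  · exact (rpow_mul_rpow_le_of_le (norm_nonneg _) hr (by linarith) h hb0).trans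
      (le_add_of_nonneg_right (by positivity))
  · rw [mul_comm]
    exact (rpow_mul_rpow_le_of_le (norm_nonneg _) hr (by linarith) h ha0).trans
      (le_add_of_nonneg_left (by positivity))

theorem integrableOn_G0_mul_G0_rpow {n : ℕ} (hn : 5 ≤ n) (i : Fin n) {p : ℝ} (hp1 : 1 ≤ p)
    (hp2 : p < (n : ℝ) / ((n : ℝ) - 2)) {x y : Euc n} (hx : 0 ≤ x i) (hy : 0 ≤ y i)
    (hxy : x ≠ y) :
    IntegrableOn (fun z => G0 n i x z * (G0 n i z y) ^ p) {z : Euc n | 0 < z i} volume := by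
  have hn' : (5 : ℝ) ≤ n := by exact_mod_cast hn
  have hn2 : 2 ≤ n := by lia
  rw [lt_div_iff₀ (by linarith)] at hp2
  have hbound := (integrable_norm_sub_rpow_mul (n := n) (a := n - 2) (b := (n - 2) * p)
    (by linarith) (by nlinarith) (by linarith) (by linarith) (by nlinarith) hxy).const_mul
      (cGreen n * cGreen n ^ p)
  refine hbound.integrableOn.mono'
    (((measurable_G0_right n i x).mul
      ((measurable_G0_left n i y).pow_const p)).aestronglyMeasurable) ?_
  filter_upwards [ae_halfspace_ne (by lia) i x, ae_halfspace_ne (by lia) i y] with z hzx hzy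
  have h₁ := G0_nonneg hn2 hx hzx.1.le hzx.2.symm
  have h₂ := G0_nonneg hn2 hzy.1.le hy hzy.2
  rw [Real.norm_of_nonneg (mul_nonneg h₁ (Real.rpow_nonneg h₂ p))]
  calc G0 n i x z * G0 n i z y ^ p
      ≤ (cGreen n * ‖x - z‖ ^ ((2 : ℝ) - n)) * (cGreen n * ‖z - y‖ ^ ((2 : ℝ) - n)) ^ p :=
        mul_le_mul (G0_le hn2 i x z) (Real.rpow_le_rpow h₂ (G0_le hn2 i z y) (by linarith))
          (Real.rpow_nonneg h₂ p) (h₁.trans (G0_le hn2 i x z))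
    _ = cGreen n * cGreen n ^ p *
          (‖z - x‖ ^ (-((n : ℝ) - 2)) * ‖z - y‖ ^ (-(((n : ℝ) - 2) * p))) := by
        rw [Real.mul_rpow (cGreen_nonneg hn2) (Real.rpow_nonneg (norm_nonneg _) _),
          ← Real.rpow_mul (norm_nonneg _), norm_sub_rev x z, neg_sub,
          show ((2 : ℝ) - n) * p = -(((n : ℝ) - 2) * p) by ring]
        ring

/-- The regular part `H̃₀` of the iterated half-space kernel
`G̃₀(x,y) = ∫_{ℝⁿ₊} G₀(x,z) G₀(z,y)ᵖ dz` is homogeneous of degree `-((n-2)p-2)`. -/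
theorem halfspace_regular_part_homogeneous
    (n : ℕ) (hn : 5 ≤ n) (i : Fin n) (hi : (i : ℕ) = n - 1)
    (p : ℝ) (hp1 : 1 ≤ p) (hp2 : p < (n : ℝ) / ((n : ℝ) - 2))
    (Gt0 : Euc n → Euc n → ℝ)
    (hGt0 : ∀ x y, Gt0 x y =
      ∫ z in {z : Euc n | 0 < z i}, G0 n i x z * (G0 n i z y) ^ p)
    (Ht0 : Euc n → Euc n → ℝ)
    (hHt0 : ∀ x y,
      Ht0 x y = alpha1 n p * ‖x - y‖ ^ (-(((n : ℝ) - 2) * p - 2)) - Gt0 x y) :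
    (∀ x : Euc n, 0 < x i → ∀ y : Euc n, 0 < y i → x ≠ y →
      IntegrableOn (fun z => G0 n i x z * (G0 n i z y) ^ p) {z : Euc n | 0 < z i} volume) ∧
    (∀ t : ℝ, 0 < t → ∀ x : Euc n, 0 < x i → ∀ y : Euc n, 0 < y i → x ≠ y →
      Ht0 (t • x) (t • y) = t ^ (-(((n : ℝ) - 2) * p - 2)) * Ht0 x y) ∧
    (p = 1 → ∀ t : ℝ, 0 < t →
      Ht0 (t • (EuclideanSpace.single i 1 : Euc n)) (t • (EuclideanSpace.single i 1 : Euc n))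
        = t ^ ((4 : ℝ) - n) *
          Ht0 (EuclideanSpace.single i 1 : Euc n) (EuclideanSpace.single i 1 : Euc n)) := by
  have hscale : ∀ t : ℝ, 0 < t → ∀ x y : Euc n, 0 < y i →
      Ht0 (t • x) (t • y) = t ^ (-(((n : ℝ) - 2) * p - 2)) * Ht0 x y := by
    intro t ht x y hy
    rw [hHt0, hHt0, hGt0, hGt0, setIntegral_G0_smul_smul (by lia) i p ht x y hy.le,
      norm_smul_sub_smul_rpow ht]
    ring
  refine ⟨fun x hx y hy hxy => integrableOn_G0_mul_G0_rpow hn i hp1 hp2 hx.le hy.le hxy,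
    fun t ht x _ y hy _ => hscale t ht x y hy, fun hp t ht => ?_⟩
  rw [hscale t ht _ _ (by simp), hp]
  congr 2
  ring
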